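/- arXiv:2303.04845 — 4 statements merged into one kernel-verified Lean document; each statement's English description precedes it below -/
import Mathlib

section
/- Let n, k, n', k', δ, N be natural numbers with k ≤ n ≤ N, k' ≤ n' ≤ N, |n − n'| ≤ δ, |k − k'| ≤ δ, and N ≥ 2. Then C(n,k) ≤ C(n',k') · N^(16·δ), where C(a,b) denotes the binomial coefficient a choose b. Equivalently, log(C(n,k)/C(n',k')) ≤ 16 δ log N. -/
/-- The binomial coefficient `C(a + b, a)` is monotone in `a` and `b`. -/
theorem choose_add_mono {a b c d : ℕ} (hac : a ≤ c) (hbd : b ≤ d) :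
    (a + b).choose a ≤ (c + d).choose c := by
  calc (a + b).choose a ≤ (a + d).choose a := Nat.choose_le_choose a (by omega)
    _ = (a + d).choose d := Nat.choose_symm_add
    _ ≤ (c + d).choose d := Nat.choose_le_choose d (by omega)
    _ = (c + d).choose c := Nat.choose_symm_add.symm

/-- Raising the lower argument together with the upper one costs a factor `N` per step. -/
theorem choose_add_left_le {N : ℕ} (a b i : ℕ) (h : a + i + b ≤ N) :
    (a + i + b).choose (a + i) ≤ (a + b).choose a * N ^ i := by
  induction i with
  | zero => simp
  | succ i ih =>
    have hsucc : (a + i + b + 1).choose (a + i + 1) ≤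
        (a + i + b + 1) * (a + i + b).choose (a + i) := by
      rw [Nat.add_one_mul_choose_eq]
      exact Nat.le_mul_of_pos_right _ (Nat.succ_pos _)
    calc (a + (i + 1) + b).choose (a + (i + 1))
        = (a + i + b + 1).choose (a + i + 1) := by congr 1; omega
      _ ≤ (a + i + b + 1) * (a + i + b).choose (a + i) := hsucc
      _ ≤ N * ((a + b).choose a * N ^ i) := Nat.mul_le_mul (by omega) (ih (by omega))
      _ = (a + b).choose a * N ^ (i + 1) := by ring

theorem choose_add_add_le {N : ℕ} (a b i j : ℕ) (h : a + i + (b + j) ≤ N) :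
    (a + i + (b + j)).choose (a + i) ≤ (a + b).choose a * N ^ (i + j) := by
  have hb := choose_add_left_le (N := N) b a j (by omega)
  rw [add_comm (b + j) a, add_comm b a, ← Nat.choose_symm_add, ← Nat.choose_symm_add] at hb
  calc (a + i + (b + j)).choose (a + i) ≤ (a + (b + j)).choose a * N ^ i :=
        choose_add_left_le a (b + j) i h
    _ ≤ (a + b).choose a * N ^ j * N ^ i := Nat.mul_le_mul_right _ hb
    _ = (a + b).choose a * N ^ (i + j) := by ring

/-- Ratio bound for binomial coefficients: if `k ≤ n ≤ N`, `k' ≤ n' ≤ N`, `N ≥ 2`, and the two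
parameter pairs differ by at most `δ` coordinatewise, then `C(n,k) ≤ C(n',k') · N^(16δ)`. -/
theorem choose_ratio_le (n k n' k' δ N : ℕ)
    (hkn : k ≤ n) (hnN : n ≤ N) (hkn' : k' ≤ n') (hnN' : n' ≤ N) (hN : 2 ≤ N)
    (hn : (n : ℤ) - n' ≤ δ ∧ (n' : ℤ) - n ≤ δ)
    (hk : (k : ℤ) - k' ≤ δ ∧ (k' : ℤ) - k ≤ δ) :
    n.choose k ≤ n'.choose k' * N ^ (16 * δ) := by
  obtain ⟨l, rfl⟩ := Nat.exists_eq_add_of_le hkn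
  obtain ⟨l', rfl⟩ := Nat.exists_eq_add_of_le hkn'
  obtain ⟨i, hi⟩ := Nat.exists_eq_add_of_le (min_le_left k k')
  obtain ⟨j, hj⟩ := Nat.exists_eq_add_of_le (min_le_left l l')
  have down := choose_add_add_le (N := N) (min k k') (min l l') i j (by omega)
  rw [← hi, ← hj] at down
  exact down.trans (Nat.mul_le_mul (choose_add_mono (min_le_right k k') (min_le_right l l'))
    (Nat.pow_le_pow_right (by omega) (by omega)))
end

section
/- Let X be a set, T ≥ 2 a natural number, x : Fin T → X a sequence of contexts, y : Fin T → {0,1} a sequence of labels, and g_1, …, g_m : X → {0,1} binary functions with m ≥ 1. Define the mixture probability q = (1/m) · Σ_{i=1}^{m} [ (n₀(g_i)+1) · C(n₀(g_i), k₀(g_i)) · (n₁(g_i)+1) · C(n₁(g_i), k₁(g_i)) ]^{-1}. Then for every binary function g* : X → {0,1}, every θ₀, θ₁ ∈ [0,1], and every i ∈ {1,…,m}, the likelihood p = θ₀^{k₀(g*)} (1−θ₀)^{n₀(g*)−k₀(g*)} · θ₁^{k₁(g*)} (1−θ₁)^{n₁(g*)−k₁(g*)} satisfies p ≤ q · m ·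 (T+1)² · T^{32·H_i}, where H_i = |{t : g*(x_t) ≠ g_i(x_t)}| is the Hamming distance between (g*(x_1),…,g*(x_T)) and (g_i(x_1),…,g_i(x_T)). -/
open Finset

/-- `nCount T x g j = n_j(g)`: the number of rounds `t` with `g(x_t) = j`. -/
def nCount {X : Type*} (T : ℕ) (x : Fin T → X) (g : X → Fin 2) (j : Fin 2) : ℕ :=
  (univ.filter fun t : Fin T => g (x t) = j).card

/-- `kCount T x y g j = k_j(g)`: the number of rounds `t` with `g(x_t) = j` and `y_t = 1`. -/
def kCount {X : Type*} (T : ℕ) (x : Fin T → X) (y : Fin T → Fin 2) (g : X → Fin 2)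
    (j : Fin 2) : ℕ :=
  (univ.filter fun t : Fin T => g (x t) = j ∧ y t = 1).card

theorem Nat.choose_add_le_pow_mul_choose {a b N : ℕ} (hb : b ≤ a) (c d : ℕ) (hd : d ≤ c)
    (hN : a + c ≤ N) : (a + c).choose (b + d) ≤ N ^ c * a.choose b := by
  induction c generalizing d with
  | zero =>
    obtain rfl : d = 0 := by omega
    simp
  | succ c ih =>
    have step : ∀ d' ≤ c, N * (a + c).choose (b + d') ≤ N ^ (c + 1) * a.choose b := by
      intro d' hd'
      rw [pow_succ', mul_assoc]
      exact Nat.mul_le_mul_left _ (ih d' hd' (by omega))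
    cases d with
    | zero =>
      refine le_trans ?_ (step 0 (by omega))
      have h := Nat.choose_mul_succ_eq (a + c) b
      calc (a + c + 1).choose b
          ≤ (a + c + 1).choose b * (a + c + 1 - b) := Nat.le_mul_of_pos_right _ (by omega)
        _ = (a + c + 1) * (a + c).choose b := by rw [← h, mul_comm]
        _ ≤ N * (a + c).choose b := Nat.mul_le_mul_right _ (by omega)
    | succ d =>
      refine le_trans ?_ (step d (by omega))
      have h := Nat.add_one_mul_choose_eq (a + c) (b + d)
      calc (a + c + 1).choose (b + d + 1)
          ≤ (a + c + 1).choose (b + d + 1) * (b + d + 1) := Nat.le_mul_of_pos_right _ (by omega)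
        _ = (a + c + 1) * (a + c).choose (b + d) := h.symm
        _ ≤ N * (a + c).choose (b + d) := Nat.mul_le_mul_right _ (by omega)

theorem Nat.choose_le_choose_add_add (a b : ℕ) {e f : ℕ} (hf : f ≤ e) :
    a.choose b ≤ (a + e).choose (b + f) := by
  have h : a.choose b ≤ (a + f).choose (b + f) := by
    clear hf
    induction f with
    | zero => simp
    | succ f ih =>
      refine ih.trans ?_
      rw [← add_assoc, ← add_assoc, Nat.choose_succ_succ]
      exact Nat.le_add_right _ _
  exact h.trans (Nat.choose_le_choose _ (by omega))

/-- Replacing a finite set `V` by `U` changes the number of ways to place the elements of a marked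
set `W` by a factor at most `N` for each element of `U` outside `V`. -/
theorem Finset.choose_card_inter_le {α : Type*} [DecidableEq α] (U V W : Finset α) {N : ℕ}
    (hN : U.card ≤ N) :
    U.card.choose (U ∩ W).card ≤ N ^ (U \ V).card * V.card.choose (V ∩ W).card := by
  have hU : U.card = (U ∩ V).card + (U \ V).card := (card_inter_add_card_sdiff U V).symm
  have hV : V.card = (U ∩ V).card + (V \ U).card := by
    rw [inter_comm, card_inter_add_card_sdiff]
  have hUW : (U ∩ W).card = (U ∩ V ∩ W).card + ((U \ V) ∩ W).card := by
    rw [← card_inter_add_card_sdiff (U ∩ W) V]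
    congr 2 <;> grind
  have hVW : (V ∩ W).card = (U ∩ V ∩ W).card + ((V \ U) ∩ W).card := by
    rw [← card_inter_add_card_sdiff (V ∩ W) U]
    congr 2 <;> grind
  calc U.card.choose (U ∩ W).card
      ≤ N ^ (U \ V).card * (U ∩ V).card.choose (U ∩ V ∩ W).card := by
        rw [hUW]
        nth_rw 1 [hU]
        exact Nat.choose_add_le_pow_mul_choose (card_le_card inter_subset_left) _ _
          (card_le_card inter_subset_left) (hU ▸ hN)
    _ ≤ N ^ (U \ V).card * V.card.choose (V ∩ W).card := by
        rw [hVW, hV]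
        exact Nat.mul_le_mul_left _
          (Nat.choose_le_choose_add_add _ _ (card_le_card inter_subset_left))

theorem pow_mul_one_sub_pow_le_inv_choose {θ : ℝ} (hθ : θ ∈ Set.Icc (0 : ℝ) 1) {n k : ℕ}
    (hk : k ≤ n) : θ ^ k * (1 - θ) ^ (n - k) ≤ ((n.choose k : ℝ))⁻¹ := by
  have h0 := hθ.1
  have h1 : 0 ≤ 1 - θ := sub_nonneg.2 hθ.2
  have hc : (0 : ℝ) < n.choose k := by exact_mod_cast Nat.choose_pos hk
  rw [← one_div, le_div_iff₀ hc]
  calc θ ^ k * (1 - θ) ^ (n - k) * (n.choose k : ℝ)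
      ≤ ∑ j ∈ range (n + 1), θ ^ j * (1 - θ) ^ (n - j) * (n.choose j : ℝ) :=
        single_le_sum (f := fun j => θ ^ j * (1 - θ) ^ (n - j) * (n.choose j : ℝ))
          (fun j _ => by positivity) (mem_range.2 (by omega))
    _ = 1 := by rw [← add_pow]; simp

theorem kCount_le_nCount {X : Type*} (T : ℕ) (x : Fin T → X) (y : Fin T → Fin 2) (g : X → Fin 2)
    (j : Fin 2) : kCount T x y g j ≤ nCount T x g j :=
  card_le_card fun t => by simp +contextual

theorem nCount_le {X : Type*} (T : ℕ) (x : Fin T → X) (g : X → Fin 2) (j : Fin 2) :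
    nCount T x g j ≤ T := by
  simpa [nCount] using card_le_univ (univ.filter fun t : Fin T => g (x t) = j)

theorem choose_nCount_kCount_le {X : Type*} (T : ℕ) (x : Fin T → X) (y : Fin T → Fin 2)
    (g h : X → Fin 2) (j : Fin 2) :
    (nCount T x g j).choose (kCount T x y g j) ≤
      T ^ (univ.filter fun t : Fin T => g (x t) = j ∧ h (x t) ≠ j).card *
        (nCount T x h j).choose (kCount T x y h j) := by
  have key := choose_card_inter_le (univ.filter fun t : Fin T => g (x t) = j)
    (univ.filter fun t : Fin T => h (x t) = j) (univ.filter fun t : Fin T => y t = 1)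
    (nCount_le T x g j)
  have hs : (univ.filter fun t : Fin T => g (x t) = j) \ (univ.filter fun t => h (x t) = j) =
      univ.filter fun t : Fin T => g (x t) = j ∧ h (x t) ≠ j := by
    ext; simp
  rwa [hs, ← filter_and, ← filter_and] at key

theorem card_flips_add_card_flips {X : Type*} (T : ℕ) (x : Fin T → X) (g h : X → Fin 2) :
    (univ.filter fun t : Fin T => g (x t) = 0 ∧ h (x t) ≠ 0).card +
        (univ.filter fun t : Fin T => g (x t) = 1 ∧ h (x t) ≠ 1).card =
      (univ.filter fun t : Fin T => h (x t) ≠ g (x t)).card := by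
  rw [← card_union_of_disjoint]
  · congr 1
    ext t
    simp only [mem_union, mem_filter, mem_univ, true_and]
    generalize g (x t) = a
    generalize h (x t) = b
    revert a b
    decide
  · rw [disjoint_filter]
    rintro t - ⟨h0, -⟩ ⟨h1, -⟩
    rw [h0] at h1
    exact absurd h1 (by decide)

/-- Pointwise regret bound for the uniform Bayesian mixture probability assignment over a finite
class `{g_1, …, g_m}` with uniform priors on `θ₀, θ₁`: the likelihood `p` of any two-level
predictor `(g*, θ₀, θ₁)` satisfies `p ≤ q · m · (T+1)² · T^(32 H_i)` where `H_i` is the Hamming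
distance between `g*` and `g_i` on the observed contexts. -/
theorem mixture_pointwise_regret_bound {X : Type*} (T m : ℕ) (hT : 2 ≤ T) (hm : 1 ≤ m)
    (x : Fin T → X) (y : Fin T → Fin 2) (g : Fin m → X → Fin 2)
    (gStar : X → Fin 2) (θ₀ θ₁ : ℝ) (hθ₀ : θ₀ ∈ Set.Icc (0:ℝ) 1) (hθ₁ : θ₁ ∈ Set.Icc (0:ℝ) 1)
    (i : Fin m) :
    θ₀ ^ kCount T x y gStar 0 * (1 - θ₀) ^ (nCount T x gStar 0 - kCount T x y gStar 0) *
        (θ₁ ^ kCount T x y gStar 1 * (1 - θ₁) ^ (nCount T x gStar 1 - kCount T x y gStar 1)) ≤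
      ((1 / (m : ℝ)) * ∑ i' : Fin m,
          1 / (((nCount T x (g i') 0 + 1 : ℝ) *
                  ((nCount T x (g i') 0).choose (kCount T x y (g i') 0) : ℝ)) *
                ((nCount T x (g i') 1 + 1 : ℝ) *
                  ((nCount T x (g i') 1).choose (kCount T x y (g i') 1) : ℝ)))) *
        (m : ℝ) * ((T : ℝ) + 1) ^ 2 *
        (T : ℝ) ^ (32 * (univ.filter fun t : Fin T => gStar (x t) ≠ g i (x t)).card) := by
  set D : Fin m → ℝ := fun i' =>
    ((nCount T x (g i') 0 + 1 : ℝ) * ((nCount T x (g i') 0).choose (kCount T x y (g i') 0) : ℝ)) *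
      ((nCount T x (g i') 1 + 1 : ℝ) *
        ((nCount T x (g i') 1).choose (kCount T x y (g i') 1) : ℝ)) with hD
  set H := (univ.filter fun t : Fin T => gStar (x t) ≠ g i (x t)).card with hH
  have hC : ∀ (f : X → Fin 2) (j : Fin 2),
      (0 : ℝ) < (nCount T x f j).choose (kCount T x y f j) := fun f j => by
    exact_mod_cast Nat.choose_pos (kCount_le_nCount T x y f j)
  have hDpos : ∀ i', 0 < D i' := fun i' => by
    have h0 := hC (g i') 0
    have h1 := hC (g i') 1
    positivity
  have hm0 : (m : ℝ) ≠ 0 := by positivity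
  have hT1 : (1 : ℝ) ≤ T := by exact_mod_cast (by omega : 1 ≤ T)
  have hT0 : (0 : ℝ) < T := by linarith
  have hlik := mul_le_mul
    (pow_mul_one_sub_pow_le_inv_choose hθ₀ (kCount_le_nCount T x y gStar 0))
    (pow_mul_one_sub_pow_le_inv_choose hθ₁ (kCount_le_nCount T x y gStar 1))
    (mul_nonneg (pow_nonneg hθ₁.1 _) (pow_nonneg (sub_nonneg.2 hθ₁.2) _))
    (inv_nonneg.2 (hC gStar 0).le)
  have hDle : D i ≤ (T + 1 : ℝ) ^ 2 * T ^ H *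
      (((nCount T x gStar 0).choose (kCount T x y gStar 0) : ℝ) *
        (nCount T x gStar 1).choose (kCount T x y gStar 1)) := by
    have hc : ∀ j, ((nCount T x (g i) j).choose (kCount T x y (g i) j) : ℝ) ≤
        T ^ (univ.filter fun t : Fin T => g i (x t) = j ∧ gStar (x t) ≠ j).card *
          (nCount T x gStar j).choose (kCount T x y gStar j) := fun j => by
      exact_mod_cast choose_nCount_kCount_le T x y (g i) gStar j
    calc D i ≤ ((T + 1 : ℝ) * (T ^ (univ.filter fun t : Fin T =>
            g i (x t) = 0 ∧ gStar (x t) ≠ 0).card *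
              (nCount T x gStar 0).choose (kCount T x y gStar 0))) *
          ((T + 1 : ℝ) * (T ^ (univ.filter fun t : Fin T =>
            g i (x t) = 1 ∧ gStar (x t) ≠ 1).card *
              (nCount T x gStar 1).choose (kCount T x y gStar 1))) := by
          simp only [hD]
          gcongr
          exacts [nCount_le T x (g i) 0, hc 0, nCount_le T x (g i) 1, hc 1]
      _ = _ := by
          rw [hH, ← card_flips_add_card_flips T x (g i) gStar, pow_add]
          ring
  have hsum : 1 / D i ≤ ∑ i', 1 / D i' :=
    single_le_sum (f := fun i' => 1 / D i') (fun i' _ => (one_div_pos.2 (hDpos i')).le)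
      (mem_univ i)
  refine hlik.trans ?_
  have hS : 1 / (m : ℝ) * (∑ i', 1 / D i') * m = ∑ i', 1 / D i' := by field_simp
  rw [hS]
  calc _ ≤ 1 / D i * ((T : ℝ) + 1) ^ 2 * T ^ H := by
        rw [← mul_inv, ← one_div, mul_assoc, one_div_mul_eq_div,
          div_le_div_iff₀ (mul_pos (hC gStar 0) (hC gStar 1)) (hDpos i), one_mul]
        exact hDle
    _ ≤ _ := by
        gcongr
        omega
end

section
/- Let X be a finite nonempty set, σ ∈ (0,1], n > 0 a real number, and λ = n/(2|X|). Let P be the product Poisson pmf with rate λ on functions v : (X × {0,1}) → ℕ, i.e., P(v) = ∏_{(x,b)} e^{−λ} λ^{v(x,b)} / (v(x,b))!. Let y : X → {0,1} be any labeling function and let D : X → [0,1] be a probability mass function on X satisfying D(x) ≤ 1/(σ|X|) for all x ∈ X. Define the mixture pmf Q(v) = Σ_{x∈X} D(x) · (v(x, y(x))/λ) · P(v). Then the chi-squared divergence satisfies χ²(Q, P) = Σ_v Q(v)²/P(v) − 1 ≤ 2/(σ n). -/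
open Finset

/-- The double sum of a product of nonnegative functions is the product of the sums. -/
theorem hasSum_mul_of_nonneg {α β : Type*} {f : α → ℝ} {g : β → ℝ} {a b : ℝ}
    (hf : ∀ i, 0 ≤ f i) (hg : ∀ j, 0 ≤ g j) (h : HasSum f a) (h' : HasSum g b) :
    HasSum (fun x : α × β => f x.1 * g x.2) (a * b) :=
  h.mul h' (h.summable.mul_of_nonneg h'.summable hf hg)

theorem hasSum_fin_prod_of_nonneg {n : ℕ} {f : Fin n → ℕ → ℝ} {a : Fin n → ℝ}
    (hf : ∀ i k, 0 ≤ f i k) (h : ∀ i, HasSum (f i) (a i)) :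
    HasSum (fun v : Fin n → ℕ => ∏ i, f i (v i)) (∏ i, a i) := by
  induction n with
  | zero => simp
  | succ n ih =>
    have h1 := ih (f := fun i => f i.succ) (a := fun i => a i.succ) (fun i => hf _) (fun i => h _)
    have h2 := hasSum_mul_of_nonneg (hf 0) (fun v => prod_nonneg fun i _ => hf _ _) (h 0) h1
    rw [Fin.prod_univ_succ, ← (Fin.consEquiv fun _ => ℕ).hasSum_iff]
    convert! h2 using 2 with v
    simp [Fin.prod_univ_succ, Fin.consEquiv]

/-- The sum over `ι → ℕ` of a product of nonnegative functions of the coordinates is the product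
of the sums. -/
theorem hasSum_pi_prod_of_nonneg {ι : Type*} [Fintype ι] {f : ι → ℕ → ℝ} {a : ι → ℝ}
    (hf : ∀ i k, 0 ≤ f i k) (h : ∀ i, HasSum (f i) (a i)) :
    HasSum (fun v : ι → ℕ => ∏ i, f i (v i)) (∏ i, a i) := by
  let e := (Fintype.equivFin ι).symm
  have h1 := hasSum_fin_prod_of_nonneg (f := fun i => f (e i)) (fun i => hf _) (fun i => h _)
  rw [e.prod_comp a] at h1
  rw [← (e.arrowCongr (Equiv.refl ℕ)).hasSum_iff]
  convert! h1 using 2 with v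
  exact (Fintype.prod_equiv e _ _ (fun i => by simp [Equiv.arrowCongr])).symm

/-- The Poisson weights sum to one. -/
theorem hasSum_poisson_weight (r : ℝ) :
    HasSum (fun k : ℕ => Real.exp (-r) * r ^ k / k.factorial) 1 := by
  have h := (NormedSpace.expSeries_div_hasSum_exp r).mul_left (Real.exp (-r))
  rw [← Real.exp_eq_exp_ℝ, ← Real.exp_add, neg_add_cancel, Real.exp_zero] at h
  simpa only [mul_div_assoc] using h

/-- Shifting the index in the Poisson weights: `𝔼[k g(k)] = r 𝔼[g(k + 1)]`. -/
theorem hasSum_poisson_weight_mul {r s : ℝ} {g : ℕ → ℝ}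
    (h : HasSum (fun k : ℕ => g (k + 1) * (Real.exp (-r) * r ^ k / k.factorial)) s) :
    HasSum (fun k : ℕ => (k * g k) * (Real.exp (-r) * r ^ k / k.factorial)) (r * s) := by
  rw [← hasSum_nat_add_iff' 1]
  simp only [range_one, sum_singleton, Nat.cast_zero, zero_mul, sub_zero]
  convert! h.mul_left r using 2 with k
  rw [Nat.factorial_succ]
  have : (k.factorial : ℝ) ≠ 0 := by positivity
  push_cast
  field_simp
  ring

theorem hasSum_poisson_mean (r : ℝ) :
    HasSum (fun k : ℕ => (k : ℝ) * (Real.exp (-r) * r ^ k / k.factorial)) r := by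
  simpa using hasSum_poisson_weight_mul (s := 1) (g := fun _ => 1)
    (by simpa only [one_mul] using hasSum_poisson_weight r)

theorem hasSum_poisson_second_moment (r : ℝ) :
    HasSum (fun k : ℕ => ((k : ℝ) * k) * (Real.exp (-r) * r ^ k / k.factorial))
      (r * (r + 1)) := by
  refine hasSum_poisson_weight_mul (g := fun k => (k : ℝ)) ?_
  simpa [add_mul] using (hasSum_poisson_mean r).add (hasSum_poisson_weight r)

/-- Mixed second moments of a vector of independent Poisson variables of rate `r`. -/
theorem hasSum_prod_poisson_mul {ι : Type*} [Fintype ι] [DecidableEq ι] {r : ℝ} (hr : 0 ≤ r)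
    (i j : ι) :
    HasSum (fun v : ι → ℕ =>
      ((v i : ℝ) * v j) * ∏ l, Real.exp (-r) * r ^ v l / (v l).factorial)
      (r ^ 2 + if i = j then r else 0) := by
  have key := hasSum_pi_prod_of_nonneg (ι := ι)
    (f := fun l k => ((if l = i then (k : ℝ) else 1) * (if l = j then (k : ℝ) else 1)) *
      (Real.exp (-r) * r ^ k / k.factorial))
    (a := fun l => (if l = i then r else 1) * (if l = j then r else 1) +
      if l = i then if l = j then r else 0 else 0)
    (fun l k => by positivity)
    (fun l => by
      split_ifs <;> try simp only [one_mul, mul_one, add_zero]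
      · simpa only [mul_add, mul_one] using hasSum_poisson_second_moment r
      · exact hasSum_poisson_mean r
      · exact hasSum_poisson_mean r
      · exact hasSum_poisson_weight r)
  convert! key using 1
  · funext v
    simp only [prod_mul_distrib, prod_ite_eq', mem_univ, if_true]
  · by_cases h : i = j
    · subst h
      rw [prod_eq_single i (fun l _ hl => by simp [hl]) (by simp)]
      simp [sq]
    · have : ∀ l, (if l = i then if l = j then r else 0 else 0) = 0 := fun l => by
        split_ifs with h1 h2
        exacts [absurd (h1.symm.trans h2) h, rfl, rfl]
      simp only [h, this, if_false, add_zero, prod_mul_distrib, prod_ite_eq', mem_univ, if_true, sq]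

/-- Bound on the χ² divergence for the smoothed Poisson mixture (paper's Lemma 4.5): with the
product Poisson pmf `P` at rate `λ = n/(2|X|)` on counts `v : X × {0,1} → ℕ`, and the mixture
`Q(v) = Σ_x D(x) (v(x,y(x))/λ) P(v)` over a `σ`-smooth pmf `D`, one has
`χ²(Q,P) = Σ_v Q(v)²/P(v) − 1 ≤ 2/(σn)`. -/
theorem chi_square_smoothed_poisson_mixture_bound {X : Type*} [Fintype X] [Nonempty X]
    (σ n : ℝ) (hσ : σ ∈ Set.Ioc (0:ℝ) 1) (hn : 0 < n)
    (lam : ℝ) (hlam : lam = n / (2 * (Fintype.card X : ℝ)))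
    (y : X → Fin 2) (D : X → ℝ) (hD_nonneg : ∀ x, 0 ≤ D x) (hD_sum : ∑ x : X, D x = 1)
    (hD_smooth : ∀ x, D x ≤ 1 / (σ * (Fintype.card X : ℝ)))
    (P Q : (X × Fin 2 → ℕ) → ℝ)
    (hP : ∀ v, P v = ∏ i : X × Fin 2, Real.exp (-lam) * lam ^ v i / (v i).factorial)
    (hQ : ∀ v, Q v = ∑ x : X, D x * ((v (x, y x) : ℝ) / lam) * P v) :
    (∑' v : X × Fin 2 → ℕ, (Q v) ^ 2 / P v) - 1 ≤ 2 / (σ * n) := by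
  classical
  obtain ⟨hσ0, -⟩ := hσ
  have hX : (0 : ℝ) < Fintype.card X := by exact_mod_cast Fintype.card_pos
  have hlam0 : 0 < lam := by rw [hlam]; positivity
  have hP0 : ∀ v, P v ≠ 0 := fun v => by rw [hP]; positivity
  have hsum : HasSum (fun v => Q v ^ 2 / P v)
      (∑ x, ∑ x', D x * D x' / lam ^ 2 * (lam ^ 2 + if x = x' then lam else 0)) := by
    have h := hasSum_sum (s := univ) fun x (_ : x ∈ univ) =>
      hasSum_sum (s := univ) fun x' (_ : x' ∈ univ) =>
        (hasSum_prod_poisson_mul hlam0.le (x, y x) (x', y x')).mul_left (D x * D x' / lam ^ 2)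
    convert! h using 1
    · funext v
      have hQv : Q v ^ 2 / P v = (∑ x, D x * (v (x, y x) / lam)) ^ 2 * P v := by
        rw [hQ, ← sum_mul]
        have := hP0 v
        field_simp
      rw [hQv, sq, sum_mul_sum, sum_mul, ← hP v]
      refine sum_congr rfl fun x _ => ?_
      rw [sum_mul]
      refine sum_congr rfl fun x' _ => ?_
      field_simp
    · refine sum_congr rfl fun x _ => sum_congr rfl fun x' _ => ?_
      by_cases hx : x = x'
      · simp [hx]
      · simp [hx]
  have hval : ∑ x, ∑ x', D x * D x' / lam ^ 2 * (lam ^ 2 + if x = x' then lam else 0)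
      = 1 + (∑ x, D x * D x) / lam := by
    have hsplit : ∀ x x', D x * D x' / lam ^ 2 * (lam ^ 2 + if x = x' then lam else 0)
        = D x * D x' + if x = x' then D x * D x' / lam else 0 := fun x x' => by
      split_ifs
      · field_simp
      · field_simp
        ring
    simp only [hsplit, sum_add_distrib, ← sum_mul_sum, hD_sum, sum_ite_eq, mem_univ, if_true,
      mul_one, sum_div]
  have hsq : ∑ x, D x * D x ≤ 1 / (σ * Fintype.card X) := by
    calc ∑ x, D x * D x ≤ ∑ x, D x * (1 / (σ * Fintype.card X)) :=
          sum_le_sum fun x _ => mul_le_mul_of_nonneg_left (hD_smooth x) (hD_nonneg x)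
      _ = 1 / (σ * Fintype.card X) := by rw [← sum_mul, hD_sum, one_mul]
  rw [hsum.tsum_eq, hval, add_sub_cancel_left]
  calc (∑ x, D x * D x) / lam ≤ 1 / (σ * Fintype.card X) / lam := by gcongr
    _ = 2 / (σ * n) := by rw [hlam]; field_simp
end

section
/- Let H be a nonempty type, T a natural number, and ℓ : Fin T → H → ℝ a sequence of loss functions. Suppose h : Fin T → H is a sequence of hypotheses such that for each t, h(t) is a minimizer of the cumulative loss up to and including round t, i.e., for all g ∈ H, Σ_{s ≤ t} ℓ(s)(h(t)) ≤ Σ_{s ≤ t} ℓ(s)(g). Then for every g ∈ H, Σ_{t=0}^{T−1} ℓ(t)(h(t)) ≤ Σ_{t=0}^{T−1} ℓ(t)(g). -/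
open Finset

/-- Be-the-leader lemma: if `h t` minimizes the cumulative loss through round `t` (inclusive),
then the total loss of the sequence `(h t)_t` is at most that of any fixed hypothesis. -/
theorem be_the_leader {H : Type*} [Nonempty H] (T : ℕ) (ℓ : Fin T → H → ℝ)
    (h : Fin T → H)
    (hmin : ∀ t : Fin T, ∀ g : H, ∑ s ∈ Iic t, ℓ s (h t) ≤ ∑ s ∈ Iic t, ℓ s g) :
    ∀ g : H, ∑ t : Fin T, ℓ t (h t) ≤ ∑ t : Fin T, ℓ t g := by
  induction T with
  | zero => simp
  | succ n ih =>
    intro g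
    have hprefix := ih (fun t => ℓ t.castSucc) (fun t => h t.castSucc)
      (fun t g => by simpa [← Fin.map_castSuccEmb_Iic] using hmin t.castSucc g) (h (Fin.last n))
    have hlast : ∑ t, ℓ t (h (Fin.last n)) ≤ ∑ t, ℓ t g := by
      simpa [← Fin.top_eq_last] using hmin (Fin.last n) g
    rw [Fin.sum_univ_castSucc] at hlast ⊢
    linarith
end
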